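/- Let λ, μ ∈ ℝ with μ > 0 and 3λ + 2μ > 0, and let y ∈ ℝ³₋. For each j ∈ {1,2,3}, the j-th column of the Neumann function, i.e. the vector field x ↦ N(x,y)e_j, is smooth on {x ∈ ℝ³ : x₃ < 0} \ {y} and satisfies the homogeneous Lamé system μ Δ(N(·,y)e_j) + (λ+μ) ∇(div(N(·,y)e_j)) = 0 there. -/

import Mathlib

open MeasureTheory Metric Set

noncomputable section

abbrev E3 := EuclideanSpace ℝ (Fin 3)

/-- Partial derivative of a scalar field in the k-th coordinate direction. -/
def pd (f : E3 → ℝ) (k : Fin 3) (x : E3) : ℝ := fderiv ℝ f x (EuclideanSpace.single k 1)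

/-- Kronecker delta. -/
def kd (i j : Fin 3) : ℝ := if i = j then 1 else 0

/-- Kelvin–Somigliana fundamental matrix `Γ` of the Lamé operator
(with `ν = λ/(2(λ+μ))`, `C_{μ,ν} = 1/(16πμ(1−ν))`). -/
def KelvinG (lam mu : ℝ) (x : E3) : Matrix (Fin 3) (Fin 3) ℝ :=
  let ν := lam / (2 * (lam + mu))
  let Cmn := 1 / (16 * Real.pi * mu * (1 - ν))
  fun i j => -Cmn * ((3 - 4*ν) * kd i j / ‖x‖ + x i * x j / ‖x‖^3)

/-- The matrix `R¹` in the decomposition of the Neumann function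
(with `c_ν = 4(1−ν)(1−2ν)`, `f̃(η) = 1/|η|`, `g̃(η) = 1/(|η| − η₃)`). -/
def Rmat1 (lam mu : ℝ) (η : E3) : Matrix (Fin 3) (Fin 3) ℝ :=
  let ν := lam / (2 * (lam + mu))
  let Cmn := 1 / (16 * Real.pi * mu * (1 - ν))
  let cν := 4 * (1 - ν) * (1 - 2*ν)
  let f := 1 / ‖η‖
  let g := 1 / (‖η‖ - η 2)
  fun i j => Cmn * ( -(f + cν * g) * kd i j - (3 - 4*ν) * η i * η j * f^3
    + cν * (kd i 2 * η j - kd j 2 * (1 - kd i 2) * η i) * f * g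
    + cν * (1 - kd i 2) * (1 - kd j 2) * η i * η j * f * g^2 )

/-- The matrix `R²` in the decomposition of the Neumann function. -/
def Rmat2 (lam mu : ℝ) (η : E3) : Matrix (Fin 3) (Fin 3) ℝ :=
  let ν := lam / (2 * (lam + mu))
  let Cmn := 1 / (16 * Real.pi * mu * (1 - ν))
  let f := 1 / ‖η‖
  fun i j => 2 * Cmn *
    ( (3 - 4*ν) * (kd i 2 * (1 - kd j 2) * η j + kd j 2 * (1 - kd i 2) * η i) * f^3
      - (1 - 2 * kd j 2) * kd i j * η 2 * f^3
      + 3 * (1 - 2 * kd j 2) * η i * η j * η 2 * f^5 )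

/-- The matrix `R³` in the decomposition of the Neumann function. -/
def Rmat3 (lam mu : ℝ) (η : E3) : Matrix (Fin 3) (Fin 3) ℝ :=
  let ν := lam / (2 * (lam + mu))
  let Cmn := 1 / (16 * Real.pi * mu * (1 - ν))
  let f := 1 / ‖η‖
  fun i j => 2 * Cmn * (1 - 2 * kd j 2) * (kd i j * f^3 - 3 * η i * η j * f^5)

/-- Reflection across the boundary plane: `ỹ = (y₁, y₂, −y₃)`. -/
def refl3 (y : E3) : E3 := y - (2 * y 2) • EuclideanSpace.single 2 1

/-- Neumann function of the Lamé operator in the half-space: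
`N(x,y) = Γ(x−y) + R¹(x−ỹ) + y₃ R²(x−ỹ) + y₃² R³(x−ỹ)`. -/
def NeumannN (lam mu : ℝ) (x y : E3) : Matrix (Fin 3) (Fin 3) ℝ :=
  fun i j => KelvinG lam mu (x - y) i j + Rmat1 lam mu (x - refl3 y) i j
    + y 2 * Rmat2 lam mu (x - refl3 y) i j + (y 2)^2 * Rmat3 lam mu (x - refl3 y) i j

inductive Ex : Type
  | c : ℝ → Ex
  | X : Fin 3 → Ex
  | Z : Fin 3 → Ex
  | f : ℕ → Ex
  | g : ℕ → Ex
  | h : ℕ → Ex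
  | add : Ex → Ex → Ex
  | mul : Ex → Ex → Ex

namespace Ex

instance : Add Ex := ⟨Ex.add⟩
instance : Mul Ex := ⟨Ex.mul⟩

def ev (y x : E3) : Ex → ℝ
  | c a => a
  | X i => (x - refl3 y) i
  | Z i => (x - y) i
  | f n => (1 / ‖x - refl3 y‖) ^ n
  | g n => (1 / (‖x - refl3 y‖ - (x - refl3 y) 2)) ^ n
  | h n => (1 / ‖x - y‖) ^ n
  | add a b => ev y x a + ev y x b
  | mul a b => ev y x a * ev y x b

def d (k : Fin 3) : Ex → Ex
  | c _ => c 0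
  | X i => c (kd i k)
  | Z i => c (kd i k)
  | f n => c (-n) * (X k * f (n + 2))
  | g n => (c (n * kd 2 k) + c (-n) * (X k * f 1)) * g (n + 1)
  | h n => c (-n) * (Z k * h (n + 2))
  | add a b => d k a + d k b
  | mul a b => d k a * b + a * d k b

@[simp] lemma ev_add (y x : E3) (a b : Ex) : ev y x (a + b) = ev y x a + ev y x b := rfl
@[simp] lemma ev_mul (y x : E3) (a b : Ex) : ev y x (a * b) = ev y x a * ev y x b := rfl
@[simp] lemma d_add (k : Fin 3) (a b : Ex) : d k (a + b) = d k a + d k b := rfl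
@[simp] lemma d_mul (k : Fin 3) (a b : Ex) : d k (a * b) = d k a * b + a * d k b := rfl

def Good (y x : E3) : Prop :=
  x - y ≠ 0 ∧ x - refl3 y ≠ 0 ∧ ‖x - refl3 y‖ - (x - refl3 y) 2 ≠ 0

lemma contDiffAt_ev (y x : E3) (hg : Good y x) (e : Ex) :
    ContDiffAt ℝ (⊤ : ℕ∞) (fun z => ev y z e) x := by
  obtain ⟨h1, h2, h3⟩ := hg
  have hX : ∀ w : E3, ∀ i : Fin 3, ContDiffAt ℝ (⊤ : ℕ∞) (fun z : E3 => (z - w) i) x := by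
    intro w i
    exact ((EuclideanSpace.proj (𝕜 := ℝ) i).contDiff (n := (⊤ : ℕ∞))).contDiffAt.comp x
      (contDiffAt_id.sub contDiffAt_const)
  have hn : ∀ w : E3, x - w ≠ 0 → ContDiffAt ℝ (⊤ : ℕ∞) (fun z : E3 => ‖z - w‖) x := by
    intro w hw
    exact (contDiffAt_id.sub contDiffAt_const).norm ℝ hw
  induction e with
  | c a => exact contDiffAt_const
  | X i => exact hX _ i
  | Z i => exact hX _ i
  | f n => exact (contDiffAt_const.div (hn _ h2) (norm_ne_zero_iff.2 h2)).pow n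
  | g n => exact (contDiffAt_const.div ((hn _ h2).sub (hX _ 2)) h3).pow n
  | h n => exact (contDiffAt_const.div (hn _ h1) (norm_ne_zero_iff.2 h1)).pow n
  | add a b ha hb => exact ha.add hb
  | mul a b ha hb => exact ha.mul hb

lemma line_X (w x : E3) (k i : Fin 3) :
    HasDerivAt (fun t : ℝ => (x + t • EuclideanSpace.single k (1 : ℝ) - w) i) (kd i k) 0 := by
  have : (fun t : ℝ => (x + t • EuclideanSpace.single k (1 : ℝ) - w) i)
      = fun t : ℝ => (x i - w i) + t * kd i k := by
    funext t
    simp [kd, Pi.single_apply]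
    ring
  rw [this]
  simpa using ((hasDerivAt_id (0 : ℝ)).mul_const (kd i k)).const_add (x i - w i)

lemma norm3 (x : E3) : ‖x‖ = Real.sqrt (x 0 ^ 2 + x 1 ^ 2 + x 2 ^ 2) := by
  rw [EuclideanSpace.norm_eq]; simp [Fin.sum_univ_three]

lemma norm3_sq (x : E3) : ‖x‖ ^ 2 = x 0 ^ 2 + x 1 ^ 2 + x 2 ^ 2 := by
  rw [norm3, Real.sq_sqrt (by positivity)]

lemma line_n (w x : E3) (k : Fin 3) (hw : x - w ≠ 0) :
    HasDerivAt (fun t : ℝ => ‖x + t • EuclideanSpace.single k (1 : ℝ) - w‖)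
      ((x - w) k / ‖x - w‖) 0 := by
  have hp : 0 < ‖x - w‖ := norm_pos_iff.2 hw
  have hsq := norm3_sq (x - w)
  have e : (fun t : ℝ => ‖x + t • EuclideanSpace.single k (1 : ℝ) - w‖) = fun t : ℝ =>
      Real.sqrt ((x + t • EuclideanSpace.single k (1 : ℝ) - w) 0 ^ 2
       + (x + t • EuclideanSpace.single k (1 : ℝ) - w) 1 ^ 2
       + (x + t • EuclideanSpace.single k (1 : ℝ) - w) 2 ^ 2) := by
    funext t; exact norm3 _
  rw [e]
  have H := ((((line_X w x k 0).pow 2).add ((line_X w x k 1).pow 2)).add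
    ((line_X w x k 2).pow 2)).sqrt (by
      simp only [zero_smul, add_zero, Pi.add_apply, Pi.pow_apply]
      rw [← hsq]; positivity)
  refine H.congr_deriv ?_
  simp only [Pi.add_apply, Pi.pow_apply, zero_smul, add_zero]
  rw [← hsq, Real.sqrt_sq hp.le]
  fin_cases k <;> simp [kd] <;> field_simp

lemma line_ev (y x : E3) (hg : Good y x) (k : Fin 3) (e : Ex) :
    HasDerivAt (fun t : ℝ => ev y (x + t • EuclideanSpace.single k (1 : ℝ)) e)
      (ev y x (d k e)) 0 := by
  obtain ⟨h1, h2, h3⟩ := hg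
  have n1 := norm_ne_zero_iff.2 h1
  have n2 := norm_ne_zero_iff.2 h2
  induction e with
  | c a => exact hasDerivAt_const _ _
  | X i => exact line_X _ _ _ _
  | Z i => exact line_X _ _ _ _
  | f n =>
    have H := (line_n (refl3 y) x k h2).inv (by simpa using n2)
    replace H := H.pow n
    refine (H.congr_deriv ?_).congr_of_eventuallyEq (Filter.Eventually.of_forall fun t => ?_)
    · cases n <;> simp [ev, d]; field_simp; ring
    · simp [ev]
  | g n =>
    have H := ((line_n (refl3 y) x k h2).sub (line_X (refl3 y) x k 2)).inv (by simpa using h3)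
    replace H := H.pow n
    refine (H.congr_deriv ?_).congr_of_eventuallyEq (Filter.Eventually.of_forall fun t => ?_)
    · cases n <;> simp [ev, d]; field_simp; ring
    · simp [ev]
  | h n =>
    have H := (line_n y x k h1).inv (by simpa using n1)
    replace H := H.pow n
    refine (H.congr_deriv ?_).congr_of_eventuallyEq (Filter.Eventually.of_forall fun t => ?_)
    · cases n <;> simp [ev, d]; field_simp; ring
    · simp [ev]
  | add a b ha hb => exact ha.add hb
  | mul a b ha hb =>
    have H := ha.mul hb
    refine H.congr_deriv ?_
    simp [d, ev]

lemma pd_ev (y x : E3) (hg : Good y x) (k : Fin 3) (e : Ex) :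
    pd (fun z => ev y z e) k x = ev y x (d k e) := by
  have h1 := ((contDiffAt_ev y x hg e).differentiableAt (by simp)).hasFDerivAt.hasLineDerivAt
    (EuclideanSpace.single k (1 : ℝ))
  exact HasDerivAt.unique h1 (line_ev y x hg k e)

lemma good_of (y x : E3) (hy : y 2 < 0) (hx : x ∈ ({x : E3 | x 2 < 0} \ {y} : Set E3)) :
    Good y x := by
  obtain ⟨hx1, hx2⟩ := hx
  have h2 : (x - refl3 y) 2 < 0 := by
    simp only [Set.mem_ofPred_eq] at hx1
    simp [refl3]; linarith
  refine ⟨sub_ne_zero.2 (by simpa using hx2), ?_, ?_⟩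
  · intro h; rw [h] at h2; simp at h2
  · have := norm_nonneg (x - refl3 y); linarith

lemma isOpen_dom (y : E3) : IsOpen ({x : E3 | x 2 < 0} \ {y} : Set E3) := by
  refine IsOpen.sdiff ?_ isClosed_singleton
  exact isOpen_lt (by fun_prop) continuous_const

def eG (C ν : ℝ) (i j : Fin 3) : Ex :=
  c (-C) * (c ((3 - 4*ν) * kd i j) * h 1 + Z i * (Z j * h 3))

def eR1 (C ν : ℝ) (i j : Fin 3) : Ex :=
  c C * (c (- kd i j) * f 1 + c (- (4 * (1 - ν) * (1 - 2*ν)) * kd i j) * g 1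
    + c (-(3 - 4*ν)) * (X i * (X j * f 3))
    + c (4 * (1 - ν) * (1 - 2*ν)) *
       ((c (kd i 2) * X j + c (-(kd j 2 * (1 - kd i 2))) * X i) * (f 1 * g 1))
    + c (4 * (1 - ν) * (1 - 2*ν) * (1 - kd i 2) * (1 - kd j 2)) *
       (X i * (X j * (f 1 * g 2))))

def eR2 (C ν : ℝ) (i j : Fin 3) : Ex :=
  c (2 * C) * ((c ((3 - 4*ν) * (kd i 2 * (1 - kd j 2))) * X j
      + c ((3 - 4*ν) * (kd j 2 * (1 - kd i 2))) * X i) * f 3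
    + c (-((1 - 2 * kd j 2) * kd i j)) * (X 2 * f 3)
    + c (3 * (1 - 2 * kd j 2)) * (X i * (X j * (X 2 * f 5))))

def eR3 (C : ℝ) (i j : Fin 3) : Ex :=
  c (2 * C * (1 - 2 * kd j 2)) * (c (kd i j) * f 3
    + c (-3) * (X i * (X j * f 5)))

def eN (C ν y2 : ℝ) (i j : Fin 3) : Ex :=
  eG C ν i j + eR1 C ν i j + c y2 * eR2 C ν i j + c (y2 * y2) * eR3 C i j

lemma ev_N (lam mu : ℝ) (x y : E3) (i j : Fin 3) :
    NeumannN lam mu x y i j = ev y x (eN (1 / (16 * Real.pi * mu * (1 - lam / (2 * (lam + mu)))))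
      (lam / (2 * (lam + mu))) (y 2) i j) := by
  simp only [NeumannN, KelvinG, Rmat1, Rmat2, Rmat3, eN, eG, eR1, eR2, eR3, ev_add, ev_mul, ev]
  ring

/-- the Lame operator with modulus divided by lambda + mu -/
def L (y x : E3) (ν : ℝ) (E : Fin 3 → Ex) (i : Fin 3) : ℝ :=
  (1 - 2 * ν) * (ev y x (d 0 (d 0 (E i))) + ev y x (d 1 (d 1 (E i))) + ev y x (d 2 (d 2 (E i))))
    + ev y x (d i (d 0 (E 0) + d 1 (E 1) + d 2 (E 2)))

set_option maxHeartbeats 8000000 in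
lemma L_G (y x : E3) (hg : Good y x) (C ν : ℝ) (i j : Fin 3) :
    L y x ν (fun i => eG C ν i j) i = 0 := by
  obtain ⟨h1, h2, h3⟩ := hg
  have n : ‖x - y‖ ≠ 0 := norm_ne_zero_iff.2 h1
  have hr := norm3_sq (x - y)
  simp only [L, eG, d_add, ev_add, d, ev, zero_mul, zero_add, add_zero, mul_zero]
  generalize ‖x - y‖ = r at *
  generalize (x - y) = v at *
  have hc : ∀ i : Fin 3, v i = ![v 0, v 1, v 2] i := by intro i; fin_cases i <;> rfl
  generalize v 0 = a at *
  generalize v 1 = b at *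
  generalize v 2 = c at *
  simp only [hc]
  clear hc
  have hr4 : r ^ 4 = (a ^ 2 + b ^ 2 + c ^ 2) ^ 2 := by rw [← hr]; ring
  have hr6 : r ^ 6 = (a ^ 2 + b ^ 2 + c ^ 2) ^ 3 := by rw [← hr]; ring
  fin_cases j <;> fin_cases i <;> simp [kd, -mul_eq_zero, -neg_add_rev] <;> field_simp <;> simp only [hr, hr4, hr6] <;> ring

set_option maxHeartbeats 8000000 in
lemma L_R1 (y x : E3) (hg : Good y x) (C ν : ℝ) (i j : Fin 3) :
    L y x ν (fun i => eR1 C ν i j) i = 0 := by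
  obtain ⟨h1, h2, h3⟩ := hg
  have n : ‖x - refl3 y‖ ≠ 0 := norm_ne_zero_iff.2 h2
  have hr := norm3_sq (x - refl3 y)
  simp only [L, eR1, d_add, ev_add, d, ev, zero_mul, zero_add, add_zero, mul_zero]
  generalize ‖x - refl3 y‖ = r at *
  generalize (x - refl3 y) = v at *
  have hc : ∀ i : Fin 3, v i = ![v 0, v 1, v 2] i := by intro i; fin_cases i <;> rfl
  generalize v 0 = a at *
  generalize v 1 = b at *
  generalize v 2 = c at *
  simp only [hc]
  clear hc
  obtain ⟨s, rfl⟩ : ∃ s, c = r - s := ⟨r - c, by ring⟩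
  have hs : s ≠ 0 := by simpa using h3
  have hr' : r = (a ^ 2 + b ^ 2 + s ^ 2) / (2 * s) := by
    field_simp; linear_combination hr
  clear hr h3
  simp only [sub_sub_cancel]
  fin_cases j <;> fin_cases i <;> simp [kd, -mul_eq_zero, -neg_add_rev] <;> field_simp <;> rw [hr'] <;> field_simp <;> ring

set_option maxHeartbeats 8000000 in
lemma L_R2 (y x : E3) (hg : Good y x) (C ν : ℝ) (i j : Fin 3) :
    L y x ν (fun i => eR2 C ν i j) i = 0 := by
  obtain ⟨h1, h2, h3⟩ := hg
  have n : ‖x - refl3 y‖ ≠ 0 := norm_ne_zero_iff.2 h2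
  have hr := norm3_sq (x - refl3 y)
  simp only [L, eR2, d_add, ev_add, d, ev, zero_mul, zero_add, add_zero, mul_zero]
  generalize ‖x - refl3 y‖ = r at *
  generalize (x - refl3 y) = v at *
  have hc : ∀ i : Fin 3, v i = ![v 0, v 1, v 2] i := by intro i; fin_cases i <;> rfl
  generalize v 0 = a at *
  generalize v 1 = b at *
  generalize v 2 = c at *
  simp only [hc]
  clear hc
  have hr4 : r ^ 4 = (a ^ 2 + b ^ 2 + c ^ 2) ^ 2 := by rw [← hr]; ring
  have hr6 : r ^ 6 = (a ^ 2 + b ^ 2 + c ^ 2) ^ 3 := by rw [← hr]; ring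
  fin_cases j <;> fin_cases i <;> simp [kd, -mul_eq_zero, -neg_add_rev] <;> field_simp <;> simp only [hr, hr4, hr6] <;> ring

set_option maxHeartbeats 8000000 in
lemma L_R3 (y x : E3) (hg : Good y x) (C ν : ℝ) (i j : Fin 3) :
    L y x ν (fun i => eR3 C i j) i = 0 := by
  obtain ⟨h1, h2, h3⟩ := hg
  have n : ‖x - refl3 y‖ ≠ 0 := norm_ne_zero_iff.2 h2
  have hr := norm3_sq (x - refl3 y)
  simp only [L, eR3, d_add, ev_add, d, ev, zero_mul, zero_add, add_zero, mul_zero]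
  generalize ‖x - refl3 y‖ = r at *
  generalize (x - refl3 y) = v at *
  have hc : ∀ i : Fin 3, v i = ![v 0, v 1, v 2] i := by intro i; fin_cases i <;> rfl
  generalize v 0 = a at *
  generalize v 1 = b at *
  generalize v 2 = c at *
  simp only [hc]
  clear hc
  have hr4 : r ^ 4 = (a ^ 2 + b ^ 2 + c ^ 2) ^ 2 := by rw [← hr]; ring
  have hr6 : r ^ 6 = (a ^ 2 + b ^ 2 + c ^ 2) ^ 3 := by rw [← hr]; ring
  fin_cases j <;> fin_cases i <;> simp [kd, -mul_eq_zero, -neg_add_rev] <;> field_simp <;> simp only [hr, hr4, hr6] <;> ring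

lemma L_N (y x : E3) (hg : Good y x) (C ν : ℝ) (i j : Fin 3) :
    L y x ν (fun i => eN C ν (y 2) i j) i = 0 := by
  have h0 := L_G y x hg C ν i j
  have h1 := L_R1 y x hg C ν i j
  have h2 := L_R2 y x hg C ν i j
  have h3 := L_R3 y x hg C ν i j
  simp only [L, eN, d_add, d_mul, ev_add, ev_mul, d, ev] at h0 h1 h2 h3 ⊢
  linear_combination h0 + h1 + (y 2) * h2 + (y 2) * (y 2) * h3

end Ex

/-- Each column `x ↦ N(x,y) eⱼ` of the Neumann function is smooth away from the pole `y`
in the half-space and solves the homogeneous Lamé system `μΔu + (λ+μ)∇(div u) = 0` there. -/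
theorem neumann_columns_solve_lame (lam mu : ℝ) (hmu : 0 < mu) (hlam : 0 < 3*lam + 2*mu)
    (y : E3) (hy : y 2 < 0) (j : Fin 3) :
    (∀ i : Fin 3,
      ContDiffOn ℝ (⊤ : ℕ∞) (fun x => NeumannN lam mu x y i j) ({x : E3 | x 2 < 0} \ {y})) ∧
    (∀ x ∈ ({x : E3 | x 2 < 0} \ {y} : Set E3), ∀ i : Fin 3,
      mu * (∑ k, pd (fun z => pd (fun v => NeumannN lam mu v y i j) k z) k x)
        + (lam + mu) *
            pd (fun z => ∑ k, pd (fun v => NeumannN lam mu v y k j) k z) i x = 0) := by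
  constructor
  · intro i x hx
    have := Ex.contDiffAt_ev y x (Ex.good_of y x hy hx)
      (Ex.eN (1 / (16 * Real.pi * mu * (1 - lam / (2 * (lam + mu)))))
      (lam / (2 * (lam + mu))) (y 2) i j)
    simp only [Ex.ev_N]
    exact this.contDiffWithinAt
  · intro x hx i
    have hg := Ex.good_of y x hy hx
    have hE : ∀ᶠ z in nhds x, Ex.Good y z := by
      filter_upwards [(Ex.isOpen_dom y).mem_nhds hx] with z hz
      exact Ex.good_of y z hy hz
    have hlm : 0 < lam + mu := by linarith
    have hN := Ex.L_N y x hg (1 / (16 * Real.pi * mu * (1 - lam / (2 * (lam + mu)))))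
      (lam / (2 * (lam + mu))) i j
    simp only [Ex.ev_N]
    generalize (1 / (16 * Real.pi * mu * (1 - lam / (2 * (lam + mu))))) = C at *
    have hmu' : mu = (lam + mu) * (1 - 2 * (lam / (2 * (lam + mu)))) := by
      field_simp; ring
    generalize lam / (2 * (lam + mu)) = ν at *
    have key : ∀ e : Ex, ∀ k l : Fin 3,
        pd (fun z => pd (fun v => Ex.ev y v e) k z) l x = Ex.ev y x (Ex.d l (Ex.d k e)) := by
      intro e k l
      rw [← Ex.pd_ev y x hg]
      unfold pd
      rw [Filter.EventuallyEq.fderiv_eq]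
      filter_upwards [hE] with z hz
      exact Ex.pd_ev y z hz k e
    have key2 : pd (fun z => ∑ k, pd (fun v => Ex.ev y v (Ex.eN C ν (y 2) k j)) k z) i x
        = Ex.ev y x (Ex.d i (Ex.d 0 (Ex.eN C ν (y 2) 0 j) + Ex.d 1 (Ex.eN C ν (y 2) 1 j)
          + Ex.d 2 (Ex.eN C ν (y 2) 2 j))) := by
      rw [← Ex.pd_ev y x hg]
      unfold pd
      rw [Filter.EventuallyEq.fderiv_eq]
      filter_upwards [hE] with z hz
      rw [Fin.sum_univ_three]
      simp only [Ex.ev_add, ← Ex.pd_ev y z hz]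
      rfl
    rw [key2, Fin.sum_univ_three, key, key, key]
    unfold Ex.L at hN
    generalize Ex.ev y x (Ex.d i (Ex.d 0 (Ex.eN C ν (y 2) 0 j) + Ex.d 1 (Ex.eN C ν (y 2) 1 j)
          + Ex.d 2 (Ex.eN C ν (y 2) 2 j))) = T at *
    generalize Ex.ev y x (Ex.d 0 (Ex.d 0 (Ex.eN C ν (y 2) i j)))
      + Ex.ev y x (Ex.d 1 (Ex.d 1 (Ex.eN C ν (y 2) i j)))
      + Ex.ev y x (Ex.d 2 (Ex.d 2 (Ex.eN C ν (y 2) i j))) = S at *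
    linear_combination (lam + mu) * hN + S * hmu'

end
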